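/- Let ρ ∈ (−1,1) and let (B,G) be a centered bivariate Gaussian with unit variances and correlation ρ. Then ρ·E[φ(B)·φ(G)] ≥ ρ²/32, where φ(s) = Φ(s) − 1/2. -/

import Mathlib

open MeasureTheory ProbabilityTheory

noncomputable def gauss (s : ℝ) : ℝ := (Real.sqrt (2 * Real.pi))⁻¹ * Real.exp (-s ^ 2 / 2)

noncomputable def PhiCDF (a : ℝ) : ℝ := ∫ t in Set.Iic a, gauss t

noncomputable def phiTr (s : ℝ) : ℝ := PhiCDF s - 1 / 2

theorem integral_cos_gaussianReal (v : NNReal) :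
    ∫ x, Real.cos x ∂(gaussianReal 0 v) = Real.exp (-v / 2) := by
  have h := charFun_gaussianReal (μ := 0) (v := v) 1
  rw [charFun_apply_real] at h
  have hint : Integrable (fun x : ℝ => Complex.exp ((1 : ℝ) * x * Complex.I))
      (gaussianReal 0 v) := by
    refine Integrable.of_bound (by fun_prop) 1 (ae_of_all _ fun x => ?_)
    rw [← Complex.ofReal_mul, Complex.norm_exp_ofReal_mul_I]
  have h2 := congrArg Complex.re h
  rw [← RCLike.re_eq_complex_re, ← integral_re hint] at h2
  have h3 : ((1 : ℝ) * (0 : ℝ) * Complex.I - v * (1 : ℝ) ^ 2 / 2 : ℂ) = ((-v / 2 : ℝ) : ℂ) := by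
    push_cast; ring
  rw [h3, ← Complex.ofReal_exp, RCLike.re_eq_complex_re, Complex.ofReal_re] at h2
  rw [← h2]
  refine integral_congr_ae (ae_of_all _ fun x => ?_)
  simp only [Complex.ofReal_one, one_mul, Complex.exp_ofReal_mul_I_re]

theorem abs_sin_mul_div_le (s t : ℝ) : |Real.sin (s * t) / t| ≤ |s| := by
  rcases eq_or_ne t 0 with rfl | ht
  · simp
  · rw [abs_div, div_le_iff₀ (abs_pos.mpr ht), ← abs_mul]
    exact Real.abs_sin_le_abs

theorem integral_cos_mul_gaussianReal (x : ℝ) :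
    ∫ t, Real.cos (x * t) ∂(gaussianReal 0 1) = Real.exp (-x ^ 2 / 2) := by
  have h := integral_cos_gaussianReal (NNReal.mk (x ^ 2) (sq_nonneg x) * 1)
  have h1 := gaussianReal_map_const_mul (μ := 0) (v := 1) x
  rw [mul_zero] at h1
  rw [← h1, integral_map (by fun_prop) (by fun_prop)] at h
  simpa using h

theorem integral_gauss_zero (s : ℝ) :
    ∫ x in (0 : ℝ)..s, gauss x =
      (Real.sqrt (2 * Real.pi))⁻¹ * ∫ t, Real.sin (s * t) / t ∂(gaussianReal 0 1) := by
  simp only [gauss, ← integral_cos_mul_gaussianReal]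
  rw [intervalIntegral.integral_const_mul]
  congr 1
  rw [intervalIntegral_integral_swap]
  · have hne : ∀ᵐ t ∂(gaussianReal 0 1), t ≠ 0 := by
      have := nullSingletonClass_gaussianReal (μ := 0) (v := 1) one_ne_zero
      exact Measure.ae_ne _ 0
    refine integral_congr_ae (hne.mono fun t ht => ?_)
    simp only
    rw [intervalIntegral.integral_comp_mul_right _ ht]
    simp [div_eq_inv_mul]
  · have : IsFiniteMeasure (volume.restrict (Set.uIoc 0 s)) :=
      ⟨by rw [Measure.restrict_apply_univ, Set.uIoc]; exact measure_Ioc_lt_top⟩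
    refine Integrable.of_bound (by fun_prop) 1 (ae_of_all _ fun x => ?_)
    exact Real.abs_cos_le_one _

theorem integrable_gauss : Integrable gauss := by
  have := integrable_exp_neg_mul_sq (b := 1 / 2) (by norm_num)
  unfold gauss
  refine Integrable.const_mul (this.congr (ae_of_all _ fun x => ?_)) _
  simp only
  congr 1; ring

theorem PhiCDF_zero : PhiCDF 0 = 1 / 2 := by
  have h := integral_comp_neg_Iic (0 : ℝ) gauss
  have h1 : ∀ x, gauss (-x) = gauss x := fun x => by simp [gauss]
  simp only [h1, neg_zero] at h
  rw [PhiCDF, h]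
  unfold gauss
  rw [integral_const_mul]
  have h2 : ∀ x : ℝ, -x ^ 2 / 2 = -(1 / 2) * x ^ 2 := fun x => by ring
  simp only [h2]
  rw [integral_gaussian_Ioi]
  have h3 : Real.pi / (1 / 2) = 2 * Real.pi := by ring
  have h4 : 0 < Real.sqrt (2 * Real.pi) := by positivity
  rw [h3]
  field_simp

theorem phiTr_eq_integral (s : ℝ) :
    phiTr s = (Real.sqrt (2 * Real.pi))⁻¹ * ∫ t, Real.sin (s * t) / t ∂(gaussianReal 0 1) := by
  rw [← integral_gauss_zero, phiTr, ← PhiCDF_zero, PhiCDF, PhiCDF,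
    intervalIntegral.integral_Iic_sub_Iic integrable_gauss.integrableOn
      integrable_gauss.integrableOn]

theorem integrable_exp_neg_sq_div_two (μ : Measure ℝ) [IsFiniteMeasure μ] :
    Integrable (fun t : ℝ => Real.exp (-t ^ 2 / 2)) μ := by
  refine Integrable.of_bound (by fun_prop) 1 (ae_of_all _ fun t => ?_)
  rw [Real.norm_eq_abs, Real.abs_exp, Real.exp_le_one_iff]
  nlinarith [sq_nonneg t]

theorem half_le_integral_exp_neg_sq :
    1 / 2 ≤ ∫ t, Real.exp (-t ^ 2 / 2) ∂(gaussianReal 0 1) := by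
  have hL : MemLp (fun t : ℝ => t) 2 (gaussianReal 0 1) := memLp_id_gaussianReal 2
  have hsq : Integrable (fun t : ℝ => t ^ 2) (gaussianReal 0 1) := hL.integrable_sq
  have hvar : ∫ t, t ^ 2 ∂(gaussianReal 0 1) = 1 := by
    have h := variance_fun_id_gaussianReal (μ := 0) (v := 1)
    rw [variance_of_integral_eq_zero (by fun_prop) (by simp)] at h
    simpa using h
  have hexp := integrable_exp_neg_sq_div_two (gaussianReal 0 1)
  calc (1 / 2 : ℝ) = ∫ t, (1 - t ^ 2 / 2) ∂(gaussianReal 0 1) := by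
        rw [integral_sub (integrable_const _) (hsq.div_const 2), integral_div, hvar]
        simp; norm_num
    _ ≤ _ := by
        refine integral_mono ((integrable_const _).sub (hsq.div_const 2)) hexp fun t => ?_
        have := Real.add_one_le_exp (-t ^ 2 / 2)
        simp only
        linarith

section JointLaw

variable {Ω : Type*} [MeasurableSpace Ω] {P : Measure Ω} {ρ : ℝ} {B G : Ω → ℝ}

theorem integral_cos_of_map_eq_gaussianReal {X : Ω → ℝ} {v : ℝ} (hv : 0 ≤ v)
    (hX : Measure.map X P = gaussianReal 0 v.toNNReal) :
    ∫ ω, Real.cos (X ω) ∂P = Real.exp (-v / 2) := by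
  have hm : AEMeasurable X P := aemeasurable_of_map_neZero (by rw [hX]; infer_instance)
  have h := integral_cos_gaussianReal v.toNNReal
  rw [← hX, integral_map hm (by fun_prop), Real.coe_toNNReal _ hv] at h
  exact h

theorem integral_sin_mul_sin [IsFiniteMeasure P] (hρ : ρ ∈ Set.Ioo (-1 : ℝ) 1)
    (hB : AEMeasurable B P) (hG : AEMeasurable G P)
    (hGauss : ∀ a b : ℝ, Measure.map (fun ω => a * B ω + b * G ω) P =
      gaussianReal 0 (Real.toNNReal (a ^ 2 + b ^ 2 + 2 * a * b * ρ))) (t u : ℝ) :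
    ∫ ω, Real.sin (B ω * t) * Real.sin (G ω * u) ∂P =
      Real.exp (-t ^ 2 / 2) * Real.exp (-u ^ 2 / 2) * Real.sinh (ρ * (t * u)) := by
  have hcos (a b : ℝ) : ∫ ω, Real.cos (a * B ω + b * G ω) ∂P =
      Real.exp (-(a ^ 2 + b ^ 2 + 2 * a * b * ρ) / 2) := by
    refine integral_cos_of_map_eq_gaussianReal ?_ (hGauss a b)
    have := hρ.1
    have := hρ.2
    nlinarith [mul_nonneg (by linarith : 0 ≤ 1 + ρ) (sq_nonneg (a + b)),
      mul_nonneg (by linarith : 0 ≤ 1 - ρ) (sq_nonneg (a - b))]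
  have hint (a b : ℝ) : Integrable (fun ω => Real.cos (a * B ω + b * G ω)) P := by
    refine Integrable.of_bound ?_ 1 (ae_of_all _ fun ω => Real.abs_cos_le_one _)
    exact (Real.measurable_cos.comp_aemeasurable
      ((hB.const_mul a).add (hG.const_mul b))).aestronglyMeasurable
  have heq (ω : Ω) : Real.sin (B ω * t) * Real.sin (G ω * u) =
      (Real.cos (t * B ω + -u * G ω) - Real.cos (t * B ω + u * G ω)) / 2 := by
    rw [neg_mul, ← sub_eq_add_neg, Real.cos_sub, Real.cos_add, mul_comm t, mul_comm u]
    ring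
  simp only [heq]
  rw [integral_div, integral_sub (hint _ _) (hint _ _), hcos, hcos, Real.sinh_eq,
    mul_div_assoc', mul_sub, ← Real.exp_add, ← Real.exp_add, ← Real.exp_add]
  ring_nf

theorem memLp_two_of_map_eq_gaussianReal {X : Ω → ℝ} {v : NNReal}
    (hX : Measure.map X P = gaussianReal 0 v) : MemLp X 2 P := by
  have hm : AEMeasurable X P := aemeasurable_of_map_neZero (by rw [hX]; infer_instance)
  have h : MemLp id 2 (Measure.map X P) := by rw [hX]; exact memLp_id_gaussianReal 2
  exact (memLp_map_measure_iff (by fun_prop) hm).mp h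

theorem integrable_sin_div_mul_sin_div (hB : MemLp B 2 P) (hG : MemLp G 2 P)
    [IsFiniteMeasure P] (μ : Measure (ℝ × ℝ)) [IsFiniteMeasure μ] :
    Integrable (fun z : Ω × (ℝ × ℝ) => Real.sin (B z.1 * z.2.1) / z.2.1 *
      (Real.sin (G z.1 * z.2.2) / z.2.2)) (P.prod μ) := by
  have hBG : Integrable (fun ω => |B ω * G ω|) P := (hB.integrable_mul hG).abs
  have hbound := hBG.mul_prod (integrable_const (1 : ℝ) : Integrable (fun _ => (1 : ℝ)) μ)
  refine hbound.mono' ?_ (ae_of_all _ fun z => ?_)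
  · have h1 : AEMeasurable (fun z : Ω × (ℝ × ℝ) => B z.1) (P.prod μ) := hB.aemeasurable.comp_fst
    have h2 : AEMeasurable (fun z : Ω × (ℝ × ℝ) => G z.1) (P.prod μ) := hG.aemeasurable.comp_fst
    have h3 : Measurable (fun z : Ω × (ℝ × ℝ) => z.2.1) := by fun_prop
    have h4 : Measurable (fun z : Ω × (ℝ × ℝ) => z.2.2) := by fun_prop
    exact (((Real.measurable_sin.comp_aemeasurable (h1.mul h3.aemeasurable)).div
      h3.aemeasurable).mul ((Real.measurable_sin.comp_aemeasurable
        (h2.mul h4.aemeasurable)).div h4.aemeasurable)).aestronglyMeasurable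
  · rw [Real.norm_eq_abs, abs_mul, mul_one, abs_mul]
    exact mul_le_mul (abs_sin_mul_div_le _ _) (abs_sin_mul_div_le _ _) (abs_nonneg _)
      (abs_nonneg _)

end JointLaw

theorem sq_le_mul_sinh_div (ρ : ℝ) {x : ℝ} (hx : x ≠ 0) :
    ρ ^ 2 ≤ ρ * (Real.sinh (ρ * x) / x) := by
  have h (y : ℝ) : y ^ 2 ≤ y * Real.sinh y := by
    rcases le_total 0 y with hy | hy
    · nlinarith [Real.self_le_sinh_iff.mpr hy]
    · nlinarith [Real.sinh_le_self_iff.mpr hy]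
  have hx2 : 0 < x ^ 2 := by positivity
  have e : ρ * (Real.sinh (ρ * x) / x) = ρ * x * Real.sinh (ρ * x) / x ^ 2 := by
    field_simp
  rw [e, le_div_iff₀ hx2]
  linarith [h (ρ * x), mul_pow ρ x 2]

theorem stmt16 {Ω : Type*} [MeasureSpace Ω] [IsProbabilityMeasure (ℙ : Measure Ω)]
    (ρ : ℝ) (hρ : ρ ∈ Set.Ioo (-1:ℝ) 1) (B G : Ω → ℝ)
    (hGauss : ∀ a b : ℝ, Measure.map (fun ω => a * B ω + b * G ω) ℙ =
      gaussianReal 0 (Real.toNNReal (a ^ 2 + b ^ 2 + 2 * a * b * ρ))) :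
    ρ ^ 2 / 32 ≤ ρ * ∫ ω, phiTr (B ω) * phiTr (G ω) := by
  have hBmap : Measure.map B ℙ = gaussianReal 0 1 := by simpa using hGauss 1 0
  have hGmap : Measure.map G ℙ = gaussianReal 0 1 := by simpa using hGauss 0 1
  have hB := memLp_two_of_map_eq_gaussianReal hBmap
  have hG := memLp_two_of_map_eq_gaussianReal hGmap
  set γ := gaussianReal 0 1
  have hne : ∀ᵐ t ∂γ, t ≠ 0 := by
    have := nullSingletonClass_gaussianReal (μ := 0) (v := 1) one_ne_zero
    exact Measure.ae_ne _ 0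
  have hI := integrable_sin_div_mul_sin_div hB hG (γ.prod γ)
  have hc : (Real.sqrt (2 * Real.pi))⁻¹ * (Real.sqrt (2 * Real.pi))⁻¹ = (2 * Real.pi)⁻¹ := by
    rw [← mul_inv, Real.mul_self_sqrt (by positivity)]
  have hrep : ∫ ω, phiTr (B ω) * phiTr (G ω) = (2 * Real.pi)⁻¹ * ∫ z : ℝ × ℝ,
      (∫ ω, Real.sin (B ω * z.1) / z.1 * (Real.sin (G ω * z.2) / z.2)) ∂(γ.prod γ) := by
    rw [← integral_integral_swap hI, ← integral_const_mul]
    refine integral_congr_ae (ae_of_all _ fun ω => ?_)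
    simp only
    rw [integral_prod_mul (fun t => Real.sin (B ω * t) / t) (fun u => Real.sin (G ω * u) / u),
      phiTr_eq_integral, phiTr_eq_integral, ← hc]
    ring
  have hexp := integrable_exp_neg_sq_div_two γ
  have hlow : ρ ^ 2 * ((∫ t, Real.exp (-t ^ 2 / 2) ∂γ) * ∫ t, Real.exp (-t ^ 2 / 2) ∂γ) ≤
      ρ * ∫ z : ℝ × ℝ,
        (∫ ω, Real.sin (B ω * z.1) / z.1 * (Real.sin (G ω * z.2) / z.2)) ∂(γ.prod γ) := by
    rw [← integral_prod_mul (fun t => Real.exp (-t ^ 2 / 2)) (fun t => Real.exp (-t ^ 2 / 2)),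
      ← integral_const_mul, ← integral_const_mul]
    refine integral_mono_ae ((hexp.mul_prod hexp).const_mul _)
      (hI.integral_prod_right.const_mul _) ?_
    filter_upwards [Measure.quasiMeasurePreserving_fst.ae hne,
      Measure.quasiMeasurePreserving_snd.ae hne] with z h1 h2
    have hω (ω : Ω) : Real.sin (B ω * z.1) / z.1 * (Real.sin (G ω * z.2) / z.2) =
        Real.sin (B ω * z.1) * Real.sin (G ω * z.2) / (z.1 * z.2) := by ring
    simp only [hω]
    rw [integral_div, integral_sin_mul_sin hρ hB.aemeasurable hG.aemeasurable hGauss]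
    have := mul_le_mul_of_nonneg_left (sq_le_mul_sinh_div ρ (mul_ne_zero h1 h2))
      (by positivity : 0 ≤ Real.exp (-z.1 ^ 2 / 2) * Real.exp (-z.2 ^ 2 / 2))
    calc _ = Real.exp (-z.1 ^ 2 / 2) * Real.exp (-z.2 ^ 2 / 2) * ρ ^ 2 := by ring
      _ ≤ _ := this
      _ = _ := by ring
  have hhalf := half_le_integral_exp_neg_sq
  have hquarter : ρ ^ 2 * (1 / 4) ≤
      ρ ^ 2 * ((∫ t, Real.exp (-t ^ 2 / 2) ∂γ) * ∫ t, Real.exp (-t ^ 2 / 2) ∂γ) :=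
    mul_le_mul_of_nonneg_left (by nlinarith) (sq_nonneg ρ)
  have hpi : (1 / 8 : ℝ) ≤ (2 * Real.pi)⁻¹ := by
    rw [one_div]
    exact inv_anti₀ (by positivity) (by linarith [Real.pi_le_four])
  rw [hrep]
  calc ρ ^ 2 / 32 = 1 / 8 * (ρ ^ 2 * (1 / 4)) := by ring
    _ ≤ (2 * Real.pi)⁻¹ * (ρ ^ 2 * (1 / 4)) := by gcongr
    _ ≤ (2 * Real.pi)⁻¹ * (ρ * ∫ z : ℝ × ℝ,
        (∫ ω, Real.sin (B ω * z.1) / z.1 * (Real.sin (G ω * z.2) / z.2)) ∂(γ.prod γ)) := by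
      exact mul_le_mul_of_nonneg_left (hquarter.trans hlow) (by positivity)
    _ = _ := by ring
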